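/- arXiv:1708.02424 — 6 statements merged into one kernel-verified Lean document; each statement's English description precedes it below -/
import Mathlib

section
/- Let n ≥ 1 and K ≥ 2 be integers, let a : Fin n → Fin n → ℝ be a symmetric matrix (a i j = a j i for all i, j), and let 𝒢 be any real number. Define c i j = 𝒢 − (2·a i j + (a i i + a j j)/(K−1)) for i < j and c i j = 0 for i ≥ j. Then for every x : Fin n → ℝ with x i ∈ {0, 1} for all i and ∑_i x i = K, one has ∑_{i < j} c i j · x i · x j = 𝒢 · K·(K−1)/2 − ∑_{i,j} a i j · x i · x j. -/
/-- The sum of a symmetric function over all pairs is twice its sum over increasing pairs plus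
its sum over the diagonal. -/
theorem sum_sum_eq_two_mul_sum_lt_add_sum_diag {ι R : Type*} [Fintype ι] [LinearOrder ι]
    [CommSemiring R] (f : ι → ι → R) (hf : ∀ i j, f i j = f j i) :
    ∑ i, ∑ j, f i j
      = 2 * ∑ i, ∑ j ∈ Finset.univ.filter (fun j => i < j), f i j + ∑ i, f i i := by
  have hsplit : ∀ i j, f i j = (if i < j then f i j else 0) + (if j < i then f j i else 0)
      + (if i = j then f i j else 0) := by
    intro i j
    rcases lt_trichotomy i j with h | h | h
    · simp [h, h.not_gt, h.ne]
    · simp [h]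
    · simp [h, h.not_gt, h.ne', hf i j]
  have hswap : ∑ i, ∑ j, (if j < i then f j i else 0) = ∑ i, ∑ j, (if i < j then f i j else 0) :=
    Finset.sum_comm
  calc ∑ i, ∑ j, f i j
      = ∑ i, ∑ j, ((if i < j then f i j else 0) + (if j < i then f j i else 0)
          + (if i = j then f i j else 0)) :=
        Finset.sum_congr rfl fun i _ => Finset.sum_congr rfl fun j _ => hsplit i j
    _ = _ := by
        simp only [Finset.sum_add_distrib, hswap, Finset.sum_filter, Finset.sum_ite_eq,
          Finset.mem_univ, if_true, two_mul]


/-- Key identity in the proof of Proposition 1: reduction of the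
equality-weighted cardinality-constrained minimum-variance problem to a
maximum edge-weighted clique problem. -/
theorem stmt_0 (n K : ℕ) (hn : 1 ≤ n) (hK : 2 ≤ K)
    (a : Fin n → Fin n → ℝ) (ha : ∀ i j, a i j = a j i)
    (G : ℝ) (c : Fin n → Fin n → ℝ)
    (hc1 : ∀ i j : Fin n, i < j →
      c i j = G - (2 * a i j + (a i i + a j j) / ((K : ℝ) - 1)))
    (hc2 : ∀ i j : Fin n, ¬ i < j → c i j = 0)
    (x : Fin n → ℝ) (hx : ∀ i, x i = 0 ∨ x i = 1)
    (hsum : ∑ i, x i = (K : ℝ)) :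
    ∑ i, ∑ j ∈ Finset.univ.filter (fun j => i < j), c i j * x i * x j
      = G * ((K : ℝ) * ((K : ℝ) - 1) / 2) - ∑ i, ∑ j, a i j * x i * x j := by
  have hK0 : (K : ℝ) - 1 ≠ 0 := by
    have : (2 : ℝ) ≤ K := by exact_mod_cast hK
    linarith
  have hsq : ∀ i, x i * x i = x i := fun i => by rcases hx i with h | h <;> simp [h]
  set f : Fin n → Fin n → ℝ := fun i j =>
    (G - (2 * a i j + (a i i + a j j) / ((K : ℝ) - 1))) * x i * x j with hf
  have hcf : ∑ i, ∑ j ∈ Finset.univ.filter (fun j => i < j), c i j * x i * x j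
      = ∑ i, ∑ j ∈ Finset.univ.filter (fun j => i < j), f i j := by
    refine Finset.sum_congr rfl fun i _ => Finset.sum_congr rfl fun j hj => ?_
    rw [hc1 i j (Finset.mem_filter.mp hj).2]
  have hsymm : ∀ i j, f i j = f j i := fun i j => by
    simp only [hf, ha i j]
    ring
  have hpairs := sum_sum_eq_two_mul_sum_lt_add_sum_diag f hsymm
  have hdiag : ∑ i, f i i = G * K - (2 + 2 / ((K : ℝ) - 1)) * ∑ i, a i i * x i := by
    rw [← hsum, Finset.mul_sum, Finset.mul_sum, ← Finset.sum_sub_distrib]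
    refine Finset.sum_congr rfl fun i _ => ?_
    simp only [hf, mul_assoc, hsq, hsum]
    ring
  have hfull : ∑ i, ∑ j, f i j = G * (K * K) - 2 * ∑ i, ∑ j, a i j * x i * x j
      - 2 * K / ((K : ℝ) - 1) * ∑ i, a i i * x i := by
    have hexp : ∀ i j, f i j = G * (x i * x j) - 2 * (a i j * x i * x j)
        - 1 / ((K : ℝ) - 1) * ((a i i * x i) * x j + x i * (a j j * x j)) := fun i j => by
      simp only [hf]
      ring
    simp only [hexp, Finset.sum_sub_distrib, Finset.sum_add_distrib, ← Finset.mul_sum,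
      ← Finset.sum_mul, hsum]
    ring
  rw [hcf]
  rw [hdiag, hfull] at hpairs
  have hcancel : 2 * K / ((K : ℝ) - 1) = 2 + 2 / ((K : ℝ) - 1) := by
    field_simp
    ring
  rw [hcancel] at hpairs
  linarith
end

section
/- Let n ≥ 1 and K ≥ 2 be integers with K ≤ n, let a : Fin n → Fin n → ℝ be a symmetric matrix (a i j = a j i for all i, j), and let 𝒢 be any real number. Define c i j = 𝒢 − (2·a i j + (a i i + a j j)/(K−1)) for i < j and c i j = 0 for i ≥ j. Let F be the set of x : Fin n → ℝ with x i ∈ {0, 1} for all i and ∑_i x i = K. Then x* ∈ F minimizes ∑_{i,j} a i j · x i · x j over F if and only if x* maximizes ∑_{i < j} c i j · x i · x j over F. -/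
/-- A symmetric double sum splits into its diagonal and twice its strictly upper part. -/
theorem sum_sum_eq_diag_add_two_mul_upper {ι : Type*} [Fintype ι] [LinearOrder ι]
    (f : ι → ι → ℝ) (hf : ∀ i j, f i j = f j i) :
    ∑ i, ∑ j, f i j =
      ∑ i, f i i + 2 * ∑ i, ∑ j ∈ Finset.univ.filter (fun j => i < j), f i j := by
  have hsplit : ∀ i j, f i j =
      (if i = j then f i j else 0) + (if i < j then f i j else 0)
        + (if j < i then f j i else 0) := by
    intro i j
    rcases lt_trichotomy i j with h | h | h
    · simp [h, h.ne, h.not_gt]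
    · simp [h]
    · simp [h, h.ne', h.not_gt, hf i j]
  have hswap : ∑ i, ∑ j, (if j < i then f j i else 0) =
      ∑ i, ∑ j, (if i < j then f i j else 0) := Finset.sum_comm
  rw [Finset.sum_congr rfl fun i _ => Finset.sum_congr rfl fun j _ => hsplit i j]
  simp only [Finset.sum_add_distrib, hswap, Finset.sum_filter, Finset.sum_ite_eq,
    Finset.mem_univ, if_true]
  ring

/-- On binary vectors with `k` ones, the clique objective with the transformed weights equals a
constant minus the quadratic form. -/
theorem sum_cliqueWeight_eq_const_sub_quadratic {ι : Type*} [Fintype ι] [LinearOrder ι]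
    (a : ι → ι → ℝ) (ha : ∀ i j, a i j = a j i) (G k : ℝ) (hk : k - 1 ≠ 0)
    (x : ι → ℝ) (hx : ∀ i, x i = 0 ∨ x i = 1) (hsum : ∑ i, x i = k) :
    ∑ i, ∑ j ∈ Finset.univ.filter (fun j => i < j),
        (G - (2 * a i j + (a i i + a j j) / (k - 1))) * x i * x j =
      G * k * (k - 1) / 2 - ∑ i, ∑ j, a i j * x i * x j := by
  have hsplit := sum_sum_eq_diag_add_two_mul_upper
    (fun i j => (G - (2 * a i j + (a i i + a j j) / (k - 1))) * x i * x j)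
    (fun i j => by rw [ha i j]; ring)
  have hfull : ∑ i, ∑ j, (G - (2 * a i j + (a i i + a j j) / (k - 1))) * x i * x j =
      G * k * k - 2 * ∑ i, ∑ j, a i j * x i * x j
        - 2 * k * (∑ i, a i i * x i) / (k - 1) := by
    have hterm : ∀ i j, (G - (2 * a i j + (a i i + a j j) / (k - 1))) * x i * x j =
        G * (x i * x j) - 2 * (a i j * x i * x j)
          - ((a i i * x i) * x j + x i * (a j j * x j)) / (k - 1) := fun i j => by ring
    simp only [hterm, Finset.sum_sub_distrib, ← Finset.sum_div, Finset.sum_add_distrib,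
      ← Finset.mul_sum, ← Finset.sum_mul, hsum]
    ring
  have hdiag : ∑ i, (G - (2 * a i i + (a i i + a i i) / (k - 1))) * x i * x i =
      G * k - 2 * (∑ i, a i i * x i) - 2 * (∑ i, a i i * x i) / (k - 1) := by
    have hterm : ∀ i, (G - (2 * a i i + (a i i + a i i) / (k - 1))) * x i * x i =
        G * x i - 2 * (a i i * x i) - 2 * (a i i * x i) / (k - 1) := fun i => by
      rcases hx i with h | h <;> rw [h] <;> ring
    simp only [hterm, Finset.sum_sub_distrib, ← Finset.sum_div, ← Finset.mul_sum, hsum]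
  rw [hfull, hdiag] at hsplit
  have hcancel : 2 * k * (∑ i, a i i * x i) / (k - 1) =
      2 * (∑ i, a i i * x i) + 2 * (∑ i, a i i * x i) / (k - 1) := by
    field_simp
    ring
  linarith


/-- Proposition 1: an instance of EWCCMVFM can be transformed into an instance
of MEWCP: minimizers of the quadratic form over binary vectors with exactly K
ones are exactly the maximizers of the edge-weighted clique objective. -/
theorem stmt_1 (n K : ℕ) (hn : 1 ≤ n) (hK : 2 ≤ K) (hKn : K ≤ n)
    (a : Fin n → Fin n → ℝ) (ha : ∀ i j, a i j = a j i)
    (G : ℝ) (c : Fin n → Fin n → ℝ)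
    (hc1 : ∀ i j : Fin n, i < j →
      c i j = G - (2 * a i j + (a i i + a j j) / ((K : ℝ) - 1)))
    (hc2 : ∀ i j : Fin n, ¬ i < j → c i j = 0)
    (F : Set (Fin n → ℝ))
    (hF : F = {x | (∀ i, x i = 0 ∨ x i = 1) ∧ ∑ i, x i = (K : ℝ)})
    (xs : Fin n → ℝ) (hxs : xs ∈ F) :
    (∀ y ∈ F, ∑ i, ∑ j, a i j * xs i * xs j ≤ ∑ i, ∑ j, a i j * y i * y j) ↔
    (∀ y ∈ F, ∑ i, ∑ j ∈ Finset.univ.filter (fun j => i < j), c i j * y i * y j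
      ≤ ∑ i, ∑ j ∈ Finset.univ.filter (fun j => i < j), c i j * xs i * xs j) := by
  have hk : (K : ℝ) - 1 ≠ 0 := by
    have : (2 : ℝ) ≤ K := by exact_mod_cast hK
    linarith
  have hobj : ∀ x ∈ F, ∑ i, ∑ j ∈ Finset.univ.filter (fun j => i < j), c i j * x i * x j =
      G * K * (K - 1) / 2 - ∑ i, ∑ j, a i j * x i * x j := by
    intro x hx
    rw [hF] at hx
    rw [← sum_cliqueWeight_eq_const_sub_quadratic a ha G K hk x hx.1 hx.2]
    refine Finset.sum_congr rfl fun i _ => Finset.sum_congr rfl fun j hj => ?_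
    rw [hc1 i j (Finset.mem_filter.mp hj).2]
  refine forall₂_congr fun y hy => ?_
  rw [hobj y hy, hobj xs hxs, sub_le_sub_iff_left]
end

section
/- Let S be a finite subset of ℝ × ℝ and let x be a point in the frontier (topological boundary) of the convex hull of S. Then there exist points p, q ∈ S such that x lies on the segment joining p and q, i.e. x ∈ segment ℝ p q. -/
universe u

/-- A strictly positive convex combination of `finrank ℝ E + 1` affinely independent points lies
in the interior of their convex hull. -/
theorem AffineIndependent.sum_smul_mem_interior_convexHull {ι E : Type*} [Fintype ι]
    [NormedAddCommGroup E] [NormedSpace ℝ E] [FiniteDimensional ℝ E] {z : ι → E}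
    (hz : AffineIndependent ℝ z) (hcard : Fintype.card ι = Module.finrank ℝ E + 1)
    {w : ι → ℝ} (hw : ∀ i, 0 < w i) (hw1 : ∑ i, w i = 1) :
    ∑ i, w i • z i ∈ interior (convexHull ℝ (Set.range z)) := by
  let b : AffineBasis ι ℝ E := ⟨z, hz, hz.affineSpan_eq_top_iff_card_eq_finrank_add_one.2 hcard⟩
  change ∑ i, w i • b i ∈ interior (convexHull ℝ (Set.range b))
  rw [b.interior_convexHull]
  intro i
  rw [← Finset.affineCombination_eq_linear_combination _ _ _ hw1,
    b.coord_apply_combination_of_mem (Finset.mem_univ i) hw1]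
  exact hw i

/-- A point of a convex hull that is not interior is a strictly positive convex combination of
at most `finrank ℝ E` points of the set. -/
theorem exists_pos_combination_card_le_finrank {E : Type u} [NormedAddCommGroup E]
    [NormedSpace ℝ E] [FiniteDimensional ℝ E] {s : Set E} {x : E} (hx : x ∈ convexHull ℝ s)
    (hxi : x ∉ interior (convexHull ℝ s)) :
    ∃ (ι : Type u) (_ : Fintype ι) (z : ι → E) (w : ι → ℝ), Fintype.card ι ≤ Module.finrank ℝ E ∧
      Set.range z ⊆ s ∧ (∀ i, 0 < w i) ∧ ∑ i, w i = 1 ∧ ∑ i, w i • z i = x := by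
  obtain ⟨ι, hι, z, w, hzs, hz, hw, hw1, rfl⟩ := eq_pos_convex_span_of_mem_convexHull hx
  refine ⟨ι, hι, z, w, ?_, hzs, hw, hw1, rfl⟩
  by_contra! hlt
  have hle : Fintype.card ι ≤ Module.finrank ℝ E + 1 :=
    hz.card_le_finrank_succ.trans (Nat.succ_le_succ (Submodule.finrank_le _))
  exact hxi (interior_mono (convexHull_mono hzs)
    (hz.sum_smul_mem_interior_convexHull (le_antisymm hle hlt) hw hw1))

/-- Corollary 1: any point on the frontier of the convex hull of a finite
planar point set is a convex combination of at most two points of the set. -/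
theorem stmt_3 (S : Finset (ℝ × ℝ)) (x : ℝ × ℝ)
    (hx : x ∈ frontier (convexHull ℝ (S : Set (ℝ × ℝ)))) :
    ∃ p ∈ S, ∃ q ∈ S, x ∈ segment ℝ p q := by
  have hclosed : IsClosed (convexHull ℝ (S : Set (ℝ × ℝ))) :=
    S.finite_toSet.isClosed_convexHull ℝ
  rw [hclosed.frontier_eq] at hx
  obtain ⟨ι, _, z, w, hcard, hzs, hw, hw1, hsum⟩ := exists_pos_combination_card_le_finrank hx.1 hx.2
  have hmem : ∀ i, z i ∈ S := fun i => hzs (Set.mem_range_self i)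
  have hcard2 : Fintype.card ι ≤ 2 := by simpa using hcard
  have hne : Nonempty ι := by
    by_contra h
    rw [not_nonempty_iff] at h
    simp at hw1
  obtain ⟨i⟩ := hne
  obtain ⟨j, hj⟩ : ∃ j, ∀ k, k = i ∨ k = j := by
    by_contra! h
    obtain ⟨j, hji, -⟩ := h i
    obtain ⟨k, hki, hkj⟩ := h j
    exact absurd (Fintype.two_lt_card_iff.2 ⟨i, j, k, hji.symm, hki.symm, hkj.symm⟩) hcard2.not_gt
  refine ⟨z i, hmem i, z j, hmem j, ?_⟩
  rw [← hsum]
  refine (convex_segment (z i) (z j)).sum_mem (fun k _ => (hw k).le) hw1 fun k _ => ?_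
  rcases hj k with rfl | rfl
  · exact left_mem_segment ℝ _ _
  · exact right_mem_segment ℝ _ _
end

section
/- Let n be a positive integer, K a natural number with 0 < K ≤ n, and a : Fin n → ℝ × ℝ a family of points in the plane. Let D = { x : Fin n → ℝ | 0 ≤ x i ≤ 1 for all i, and ∑_i x i = K }, and define f : (Fin n → ℝ) → ℝ by f x = (∑_i x i · (a i).1)² + ∑_i x i · (a i).2. Then there exists x* ∈ D such that f x* ≤ f y for all y ∈ D, and the set { i : Fin n | x* i ≠ 0 ∧ x* i ≠ 1 } has cardinality at most 2. -/
/-- From a point of the unit cube one can move in any nonzero direction, without leaving the cube,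
until one of the moving coordinates is `0` or `1`. -/
theorem exists_step_to_cube_boundary {ι : Type*} [Fintype ι] {x d : ι → ℝ}
    (hx : ∀ i, 0 ≤ x i ∧ x i ≤ 1) (hd : d ≠ 0) :
    ∃ t : ℝ, 0 ≤ t ∧ (∀ i, 0 ≤ x i + t * d i ∧ x i + t * d i ≤ 1) ∧
      ∃ i, d i ≠ 0 ∧ (x i + t * d i = 0 ∨ x i + t * d i = 1) := by
  classical
  let r : ι → ℝ := fun i => if 0 < d i then (1 - x i) / d i else -x i / d i
  obtain ⟨j, hj⟩ := Function.ne_iff.mp hd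
  obtain ⟨k, hk, hmin⟩ := Finset.exists_min_image (Finset.univ.filter fun i => d i ≠ 0) r
    ⟨j, by simpa using hj⟩
  simp only [Finset.mem_filter, Finset.mem_univ, true_and] at hk hmin
  have hr : 0 ≤ r k := by
    simp only [r]
    split_ifs with h
    · exact div_nonneg (by linarith [(hx k).2]) h.le
    · exact div_nonneg_of_nonpos (by linarith [(hx k).1]) (not_lt.mp h)
  refine ⟨r k, hr, fun i => ?_, k, hk, ?_⟩
  · rcases lt_trichotomy (d i) 0 with h | h | h
    · have hle := hmin i h.ne
      have hri : r i = -x i / d i := if_neg h.not_gt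
      rw [hri, le_div_iff_of_neg h] at hle
      exact ⟨by linarith, by nlinarith [(hx i).2]⟩
    · simpa [h] using hx i
    · have hle := hmin i h.ne'
      have hri : r i = (1 - x i) / d i := if_pos h
      rw [hri, le_div_iff₀ h] at hle
      exact ⟨by nlinarith [(hx i).1], by linarith⟩
  · by_cases h : 0 < d k
    · right
      have hrk : r k = (1 - x k) / d k := if_pos h
      rw [hrk, div_mul_cancel₀ _ hk]
      ring
    · left
      have hrk : r k = -x k / d k := if_neg h
      rw [hrk, div_mul_cancel₀ _ hk]
      ring

/-- Three coordinates always support a nonzero vector orthogonal to `1` and to a given `p`. -/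
theorem exists_ne_zero_sum_eq_zero_sum_mul_eq_zero {ι : Type*} [Fintype ι] (p : ι → ℝ)
    {i j k : ι} (hij : i ≠ j) (hik : i ≠ k) (hjk : j ≠ k) :
    ∃ d : ι → ℝ, d ≠ 0 ∧ ∑ l, d l = 0 ∧ ∑ l, d l * p l = 0 ∧
      ∀ l, d l ≠ 0 → l = i ∨ l = j ∨ l = k := by
  classical
  obtain ⟨u, v, w, hne, hsum, hp⟩ : ∃ u v w : ℝ, (u ≠ 0 ∨ w ≠ 0) ∧ u + v + w = 0 ∧
      u * p i + v * p j + w * p k = 0 := by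
    by_cases h : p i = p j
    · exact ⟨1, -1, 0, Or.inl one_ne_zero, by ring, by rw [h]; ring⟩
    · exact ⟨p j - p k, p k - p i, p i - p j, Or.inr (sub_ne_zero.mpr h), by ring, by ring⟩
  refine ⟨Pi.single i u + Pi.single j v + Pi.single k w, fun h => ?_, ?_, ?_, fun l hl => ?_⟩
  · have hi := congrFun h i
    have hk := congrFun h k
    simp [hij, hik] at hi
    simp [hik.symm, hjk.symm] at hk
    tauto
  · simpa [Finset.sum_add_distrib] using hsum
  · simpa [Finset.sum_add_distrib, add_mul, Pi.single_apply] using hp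
  · by_contra! h
    simp [h] at hl

/-- A point of the unit cube with more than two fractional coordinates can be replaced by one with
fewer, keeping two linear functionals fixed and not increasing a third. -/
theorem exists_ncard_fractional_lt {ι : Type*} [Fintype ι] (p q : ι → ℝ) {x : ι → ℝ}
    (hx : ∀ i, 0 ≤ x i ∧ x i ≤ 1) (hcard : 2 < {i | x i ≠ 0 ∧ x i ≠ 1}.ncard) :
    ∃ y : ι → ℝ, (∀ i, 0 ≤ y i ∧ y i ≤ 1) ∧ ∑ i, y i = ∑ i, x i ∧
      ∑ i, y i * p i = ∑ i, x i * p i ∧ ∑ i, y i * q i ≤ ∑ i, x i * q i ∧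
      {i | y i ≠ 0 ∧ y i ≠ 1}.ncard < {i | x i ≠ 0 ∧ x i ≠ 1}.ncard := by
  obtain ⟨i, j, k, hi, hj, hk, hij, hik, hjk⟩ := (Set.two_lt_ncard_iff (Set.toFinite _)).mp hcard
  obtain ⟨d, hd, hsum, hp, hsupp, hq⟩ : ∃ d : ι → ℝ, d ≠ 0 ∧ ∑ l, d l = 0 ∧
      ∑ l, d l * p l = 0 ∧ (∀ l, d l ≠ 0 → l = i ∨ l = j ∨ l = k) ∧ ∑ l, d l * q l ≤ 0 := by
    obtain ⟨d, hd, hsum, hp, hsupp⟩ := exists_ne_zero_sum_eq_zero_sum_mul_eq_zero p hij hik hjk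
    rcases le_total (∑ l, d l * q l) 0 with h | h
    · exact ⟨d, hd, hsum, hp, hsupp, h⟩
    · exact ⟨-d, neg_ne_zero.mpr hd, by simpa using hsum, by simpa using hp,
        by simpa using hsupp, by simpa using h⟩
  have hfrac : ∀ l, d l ≠ 0 → x l ≠ 0 ∧ x l ≠ 1 := fun l hl => by
    rcases hsupp l hl with rfl | rfl | rfl <;> assumption
  obtain ⟨t, ht, hbox, m, hm, hint⟩ := exists_step_to_cube_boundary hx hd
  have hlin : ∀ c : ι → ℝ, ∑ l, (x l + t * d l) * c l = ∑ l, x l * c l + t * ∑ l, d l * c l := by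
    intro c
    simp only [add_mul, Finset.sum_add_distrib, Finset.mul_sum, mul_assoc]
  refine ⟨fun l => x l + t * d l, hbox, ?_, ?_, ?_, Set.ncard_lt_ncard ?_ (Set.toFinite _)⟩
  · simp [Finset.sum_add_distrib, ← Finset.mul_sum, hsum]
  · rw [hlin, hp, mul_zero, add_zero]
  · rw [hlin]
    linarith [mul_nonpos_of_nonneg_of_nonpos ht hq]
  · refine (Set.ssubset_iff_of_subset fun l hl => ?_).mpr ⟨m, hfrac m hm, fun h => ?_⟩
    · by_cases h : d l = 0
      · simpa [h] using hl
      · exact hfrac l h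
    · exact hint.elim h.1 h.2

/-- A continuous function attains its minimum on the slice of the unit cube where the coordinates
sum to `s`, provided `s` lies between `0` and the dimension. -/
theorem exists_isMinOn_cube_slice {ι : Type*} [Fintype ι] [Nonempty ι] {s : ℝ} (hs0 : 0 ≤ s)
    (hs : s ≤ Fintype.card ι) {f : (ι → ℝ) → ℝ} (hf : Continuous f) :
    ∃ x ∈ {x : ι → ℝ | (∀ i, 0 ≤ x i ∧ x i ≤ 1) ∧ ∑ i, x i = s},
      IsMinOn f {x : ι → ℝ | (∀ i, 0 ≤ x i ∧ x i ≤ 1) ∧ ∑ i, x i = s} x := by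
  have hcard : (0 : ℝ) < Fintype.card ι := by exact_mod_cast Fintype.card_pos
  have hcompact : IsCompact {x : ι → ℝ | (∀ i, 0 ≤ x i ∧ x i ≤ 1) ∧ ∑ i, x i = s} := by
    have hclosed : IsClosed {x : ι → ℝ | ∑ i, x i = s} :=
      isClosed_eq (by fun_prop) continuous_const
    convert (isCompact_Icc (a := (0 : ι → ℝ)) (b := 1)).inter_right hclosed using 1
    ext x
    simp [Pi.le_def, forall_and]
  refine hcompact.exists_isMinOn ⟨fun _ => s / Fintype.card ι, fun _ => ?_, ?_⟩ hf.continuousOn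
  · exact ⟨by positivity, (div_le_one hcard).mpr hs⟩
  · simp [mul_div_cancel₀ _ hcard.ne']


/-- Proposition 3: the linear relaxation of the EWCCMVSF problem admits an
optimal solution with at most two fractional variables. -/
theorem stmt_5 (n K : ℕ) (hn : 0 < n) (hK0 : 0 < K) (hK : K ≤ n)
    (a : Fin n → ℝ × ℝ)
    (D : Set (Fin n → ℝ))
    (hD : D = {x | (∀ i, 0 ≤ x i ∧ x i ≤ 1) ∧ ∑ i, x i = (K : ℝ)})
    (f : (Fin n → ℝ) → ℝ)
    (hf : ∀ x, f x = (∑ i, x i * (a i).1) ^ 2 + ∑ i, x i * (a i).2) :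
    ∃ xs ∈ D, (∀ y ∈ D, f xs ≤ f y) ∧
      ({i : Fin n | xs i ≠ 0 ∧ xs i ≠ 1}).ncard ≤ 2 := by
  subst hD
  have : Nonempty (Fin n) := ⟨⟨0, hn⟩⟩
  have hcont : Continuous f := by
    rw [funext hf]
    fun_prop
  obtain ⟨x₀, hx₀, hmin₀⟩ := exists_isMinOn_cube_slice (ι := Fin n) (s := K) (by positivity)
    (by simpa using hK) hcont
  induction hm : ({i : Fin n | x₀ i ≠ 0 ∧ x₀ i ≠ 1}).ncard using Nat.strong_induction_on
    generalizing x₀ with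
  | _ m ih =>
    by_cases hcard : ({i : Fin n | x₀ i ≠ 0 ∧ x₀ i ≠ 1}).ncard ≤ 2
    · exact ⟨x₀, hx₀, fun y hy => hmin₀ hy, hcard⟩
    · obtain ⟨y, hy, hsum, hp, hq, hlt⟩ := exists_ncard_fractional_lt (fun i => (a i).1)
        (fun i => (a i).2) hx₀.1 (not_le.mp hcard)
      refine ih _ (hm ▸ hlt) y ⟨hy, hsum.trans hx₀.2⟩ (fun z hz => ?_) rfl
      have hle : f y ≤ f x₀ := by
        rw [hf, hf, hp]
        gcongr
      exact hle.trans (hmin₀ hz)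
end

section
/- Let ι be a type, β : ι → ℝ and σε2 : ι → ℝ functions, and σf2 ≥ 0 a real number. For a finite set T ⊆ ι define obj(T) = ∑_{k ∈ T} σε2 k + σf2 · (∑_{k ∈ T} β k)², and for a finite set S and elements i, j ∉ S say that i is better than j for S (written i ≪_S j) if obj(S ∪ {i}) ≤ obj(S ∪ {j}). Let S*, S be finite subsets of ι and i, j elements with i ∉ S*, j ∉ S*, i ∉ S, j ∉ S. If i ≪_{S*} j and (∑_{k ∈ S*} β k − ∑_{k ∈ S} β k) · (β i − β j) > 0, then i ≪_S j. -/
/-- Proposition 4: if asset i is better than asset j for S*, and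
(β_{S*} − β_S)(β_i − β_j) > 0, then i is better than j for S. -/
theorem stmt_7 {ι : Type*} [DecidableEq ι] (β σε2 : ι → ℝ) (σf2 : ℝ)
    (hσ : 0 ≤ σf2)
    (obj : Finset ι → ℝ)
    (hobj : ∀ T, obj T = ∑ k ∈ T, σε2 k + σf2 * (∑ k ∈ T, β k) ^ 2)
    (Sstar S : Finset ι) (i j : ι)
    (hi1 : i ∉ Sstar) (hj1 : j ∉ Sstar) (hi2 : i ∉ S) (hj2 : j ∉ S)
    (hbetter : obj (insert i Sstar) ≤ obj (insert j Sstar))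
    (hprod : (∑ k ∈ Sstar, β k - ∑ k ∈ S, β k) * (β i - β j) > 0) :
    obj (insert i S) ≤ obj (insert j S) := by
  rw [hobj, hobj, Finset.sum_insert hi1, Finset.sum_insert hi1, Finset.sum_insert hj1,
    Finset.sum_insert hj1] at hbetter
  rw [hobj, hobj, Finset.sum_insert hi2, Finset.sum_insert hi2, Finset.sum_insert hj2,
    Finset.sum_insert hj2]
  have h := mul_nonneg hσ hprod.le
  linarith
end

section
/- Let n be a positive integer, K a positive real number, σf2 ≥ 0 a real number, σε2 : Fin n → ℝ any function, and β : Fin n → ℝ a monotone nondecreasing function (i ≤ j implies β i ≤ β j). Define the matrix M by M i j = (σε2 i + σε2 j)/(2·K) + σf2 · β i · β j. Then M satisfies the inverse Monge property: for all indices i < j and k < l, M i k + M j l ≥ M i l + M j k. -/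
/-- Proposition 5: the underlying matrix of the EWCCMVSF problem, with assets
ordered by nondecreasing β, is an inverse Monge matrix. -/
theorem stmt_9 (n : ℕ) (hn : 0 < n) (K : ℝ) (hK : 0 < K)
    (σf2 : ℝ) (hσ : 0 ≤ σf2)
    (σε2 : Fin n → ℝ) (β : Fin n → ℝ) (hβ : Monotone β)
    (M : Fin n → Fin n → ℝ)
    (hM : ∀ i j, M i j = (σε2 i + σε2 j) / (2 * K) + σf2 * β i * β j)
    (i j k l : Fin n) (hij : i < j) (hkl : k < l) :
    M i l + M j k ≤ M i k + M j l := by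
  have h : 0 ≤ σf2 * ((β j - β i) * (β l - β k)) :=
    mul_nonneg hσ (mul_nonneg (sub_nonneg.2 (hβ hij.le)) (sub_nonneg.2 (hβ hkl.le)))
  simp only [hM, add_div]
  linarith
end
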